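/- The I and Q positivity conditions imply the Pauli exclusion principle at the one-particle level: let N be an integer with 2 ≤ N and M ≥ N + 2 (M the cardinality of ι), and let Γ be a two-particle density matrix with the fermionic symmetries and trace normalization. If Γ is positive semidefinite then its one-particle density matrix ρ is positive semidefinite, and if in addition the matrix Q(1, 1/(N(N−1)), 1/(N−1))(Γ) is positive semidefinite then 1 − ρ is positive semidefinite; consequently all eigenvalues of ρ lie in the interval [0, 1]. -/

import Mathlib

open Matrix

/-- The partial trace of a matrix on pair indices:
`Γ̄_{αγ} = Σ_λ Γ_{(α,λ),(γ,λ)}`. -/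
def pTr {ι : Type*} [Fintype ι] (Γ : Matrix (ι × ι) (ι × ι) ℝ) : Matrix ι ι ℝ :=
  fun α γ => ∑ l : ι, Γ (α, l) (γ, l)

/-- The double trace `Γ̄̄ = Σ_α Γ̄_{αα}`. -/
def dTr {ι : Type*} [Fintype ι] (Γ : Matrix (ι × ι) (ι × ι) ℝ) : ℝ :=
  ∑ α : ι, pTr Γ α α

/-- The generalized `Q` map with coefficients `(a, b, c)`:
`Q(a,b,c)(Γ)_{(α,β),(γ,δ)} = a·Γ_{(α,β),(γ,δ)}
  + b·(δ_{αγ}δ_{βδ} − δ_{αδ}δ_{βγ})·Γ̄̄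
  − c·(δ_{αγ}Γ̄_{βδ} − δ_{βγ}Γ̄_{αδ} − δ_{αδ}Γ̄_{βγ} + δ_{βδ}Γ̄_{αγ})`. -/
def Qgen {ι : Type*} [Fintype ι] [DecidableEq ι] (a b c : ℝ)
    (Γ : Matrix (ι × ι) (ι × ι) ℝ) : Matrix (ι × ι) (ι × ι) ℝ :=
  fun p q =>
    a * Γ p q
    + b * ((if p.1 = q.1 then (1 : ℝ) else 0) * (if p.2 = q.2 then (1 : ℝ) else 0)
        - (if p.1 = q.2 then (1 : ℝ) else 0) * (if p.2 = q.1 then (1 : ℝ) else 0)) * dTr Γ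
    - c * ((if p.1 = q.1 then (1 : ℝ) else 0) * pTr Γ p.2 q.2
        - (if p.2 = q.1 then (1 : ℝ) else 0) * pTr Γ p.1 q.2
        - (if p.1 = q.2 then (1 : ℝ) else 0) * pTr Γ p.2 q.1
        + (if p.2 = q.2 then (1 : ℝ) else 0) * pTr Γ p.1 q.1)

/-- The fermionic symmetries of a matrix on pair indices. -/
def FermionicSym {ι : Type*} (Γ : Matrix (ι × ι) (ι × ι) ℝ) : Prop :=
  ∀ α β γ δ : ι,
    Γ (α, β) (γ, δ) = -Γ (β, α) (γ, δ) ∧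
    Γ (α, β) (γ, δ) = -Γ (α, β) (δ, γ) ∧
    Γ (α, β) (γ, δ) = Γ (γ, δ) (α, β)

/-- The trace normalization of a two-particle density matrix for `N` particles. -/
def TraceNorm {ι : Type*} [Fintype ι] (N : ℕ) (Γ : Matrix (ι × ι) (ι × ι) ℝ) : Prop :=
  (1 / 2 : ℝ) * (∑ α : ι, ∑ β : ι, Γ (α, β) (α, β)) = (N : ℝ) * ((N : ℝ) - 1) / 2

/-- The one-particle density matrix `ρ_{αγ} = (N−1)⁻¹ · Σ_β Γ_{(α,β),(γ,β)}`. -/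
noncomputable def rho1 {ι : Type*} [Fintype ι] (N : ℕ)
    (Γ : Matrix (ι × ι) (ι × ι) ℝ) : Matrix ι ι ℝ :=
  fun α γ => ((N : ℝ) - 1)⁻¹ * ∑ β : ι, Γ (α, β) (γ, β)

/-- The partial trace of a positive semidefinite matrix is positive semidefinite. -/
theorem pTr_posSemidef {ι : Type*} [Fintype ι] {Γ : Matrix (ι × ι) (ι × ι) ℝ}
    (h : Γ.PosSemidef) : (pTr Γ).PosSemidef := by
  have hsum : pTr Γ = ∑ l : ι, Γ.submatrix (fun α => (α, l)) (fun α => (α, l)) := by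
    ext α γ
    simp [pTr, Matrix.sum_apply]
  rw [hsum]
  exact Matrix.posSemidef_sum _ fun l _ => h.submatrix _

/-- The one-particle density matrix is a multiple of the partial trace. -/
theorem rho1_eq_smul_pTr {ι : Type*} [Fintype ι] (N : ℕ) (Γ : Matrix (ι × ι) (ι × ι) ℝ) :
    rho1 N Γ = ((N : ℝ) - 1)⁻¹ • pTr Γ :=
  rfl

/-- The partial trace of the generalized `Q` map. -/
theorem pTr_Qgen {ι : Type*} [Fintype ι] [DecidableEq ι] (a b c : ℝ)
    (Γ : Matrix (ι × ι) (ι × ι) ℝ) :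
    pTr (Qgen a b c Γ) =
      ((b * ((Fintype.card ι : ℝ) - 1) - c) * dTr Γ) • (1 : Matrix ι ι ℝ)
        + (a - c * ((Fintype.card ι : ℝ) - 2)) • pTr Γ := by
  ext α γ
  have hΓ : ∑ l, Γ (α, l) (γ, l) = pTr Γ α γ := rfl
  have hd : ∑ l, pTr Γ l l = dTr Γ := rfl
  rw [pTr]
  simp only [Qgen, Finset.sum_add_distrib, Finset.sum_sub_distrib, ← Finset.mul_sum,
    ← Finset.sum_mul, hΓ, Matrix.add_apply, Matrix.smul_apply, Matrix.one_apply, smul_eq_mul]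
  simp only [ite_mul, one_mul, zero_mul, if_true, Finset.sum_ite_eq, Finset.sum_ite_eq', Finset.mem_univ]
  split_ifs <;>
    simp only [hd, Finset.sum_const, Finset.card_univ, nsmul_eq_mul] <;>
    ring

/-- Eigenvalues of a positive semidefinite real matrix are nonnegative. -/
theorem nonneg_of_mulVec_eq_smul {ι : Type*} [Fintype ι] {A : Matrix ι ι ℝ}
    (hA : A.PosSemidef) {μ : ℝ} {v : ι → ℝ} (hv : v ≠ 0) (h : A.mulVec v = μ • v) : 0 ≤ μ := by
  have hnonneg := hA.dotProduct_mulVec_nonneg v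
  have hpos : 0 < star v ⬝ᵥ v := Matrix.dotProduct_star_self_pos_iff.mpr hv
  rw [h, dotProduct_smul, smul_eq_mul] at hnonneg
  exact nonneg_of_mul_nonneg_left hnonneg hpos

/-- The `I` and `Q` positivity conditions imply the Pauli exclusion principle at
the one-particle level: if `Γ ⪰ 0` then `ρ ⪰ 0`, and if in addition the
homogeneous `Q` map of `Γ` is positive semidefinite then `1 − ρ ⪰ 0`;
consequently all eigenvalues of `ρ` lie in `[0, 1]`. -/
theorem IQ_conditions_imply_pauli
    {ι : Type*} [Fintype ι] [DecidableEq ι] (N : ℕ) (hN : 2 ≤ N)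
    (hM : N + 2 ≤ Fintype.card ι)
    (Γ : Matrix (ι × ι) (ι × ι) ℝ) (hsym : FermionicSym Γ) (htr : TraceNorm N Γ)
    (hI : Γ.PosSemidef) :
    (rho1 N Γ).PosSemidef ∧
    ((Qgen 1 (1 / ((N : ℝ) * ((N : ℝ) - 1))) (1 / ((N : ℝ) - 1)) Γ).PosSemidef →
      ((1 : Matrix ι ι ℝ) - rho1 N Γ).PosSemidef ∧
      ∀ (μ : ℝ) (v : ι → ℝ), v ≠ 0 → (rho1 N Γ).mulVec v = μ • v →
        μ ∈ Set.Icc (0 : ℝ) 1) := by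
  have hN' : (2 : ℝ) ≤ N := by exact_mod_cast hN
  have hM' : (N : ℝ) + 2 ≤ Fintype.card ι := by exact_mod_cast hM
  have hN1 : (0 : ℝ) < (N : ℝ) - 1 := by linarith
  have hρ : (rho1 N Γ).PosSemidef := by
    rw [rho1_eq_smul_pTr]
    exact (pTr_posSemidef hI).smul (inv_nonneg.mpr hN1.le)
  refine ⟨hρ, fun hQ => ?_⟩
  have hd : dTr Γ = (N : ℝ) * ((N : ℝ) - 1) := by
    have h : dTr Γ = ∑ α : ι, ∑ β : ι, Γ (α, β) (α, β) := rfl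
    unfold TraceNorm at htr
    linarith
  have hscale : (1 : Matrix ι ι ℝ) - rho1 N Γ = ((Fintype.card ι : ℝ) - 1 - N)⁻¹ •
      pTr (Qgen 1 (1 / ((N : ℝ) * ((N : ℝ) - 1))) (1 / ((N : ℝ) - 1)) Γ) := by
    have hN0 : (N : ℝ) ≠ 0 := by linarith
    have hN1' : (N : ℝ) - 1 ≠ 0 := hN1.ne'
    have hK : (Fintype.card ι : ℝ) - 1 - N ≠ 0 := by linarith
    rw [pTr_Qgen, hd, rho1_eq_smul_pTr]
    ext α γ
    simp only [Matrix.sub_apply, Matrix.add_apply, Matrix.smul_apply, smul_eq_mul]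
    field_simp
    ring
  have hPauli : ((1 : Matrix ι ι ℝ) - rho1 N Γ).PosSemidef := by
    rw [hscale]
    exact (pTr_posSemidef hQ).smul (inv_nonneg.mpr (by linarith))
  refine ⟨hPauli, fun μ v hv h => ⟨nonneg_of_mulVec_eq_smul hρ hv h, ?_⟩⟩
  have hsub : ((1 : Matrix ι ι ℝ) - rho1 N Γ).mulVec v = (1 - μ) • v := by
    rw [Matrix.sub_mulVec, Matrix.one_mulVec, h, sub_smul, one_smul]
  linarith [nonneg_of_mulVec_eq_smul hPauli hv hsub]
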